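/- arXiv:2102.04393 — 2 statements merged into one kernel-verified Lean document; each statement's English description precedes it below -/
import Mathlib

section
/- Assume the plant is open-loop stable, i.e. A is a stable matrix. Let Λ ∈ ℝ^{n×n} be any stable matrix and set K* := (Λ, 0_{n×p}, 0_{m×n}). Then K* ∈ 𝒞_n. Moreover, if X_op, Y_op ∈ ℝ^{n×n} satisfy A·X_op + X_op·Aᵀ + W = 0 and Aᵀ·Y_op + Y_op·A + Q = 0, then X := diag(X_op, 0_{n×n}) is a symmetric solution of the X-equation for K*, Y := diag(Y_op, 0_{n×n}) is a symmetric solution of the Y-equation for K*, and the LQG gradient expressions of K* computed from X and Y all vanish; that is, K* is a stationary point of the LQG cost over 𝒞_n. -/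
open Matrix

noncomputable section

/-- A real square matrix is stable (Hurwitz): every eigenvalue of the matrix,
regarded as a complex matrix, has negative real part. -/
def IsStableMatrix {k : Type*} [Fintype k] [DecidableEq k] (M : Matrix k k ℝ) : Prop :=
  ∀ μ ∈ spectrum ℂ (M.map (algebraMap ℝ ℂ)), μ.re < 0

/-- The closed-loop matrix of the plant `(A, B, C)` with a full-order dynamic controller
`K = (A_K, B_K, C_K)`. -/
def Acl {n m p : ℕ} (A : Matrix (Fin n) (Fin n) ℝ) (B : Matrix (Fin n) (Fin m) ℝ)
    (C : Matrix (Fin p) (Fin n) ℝ)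
    (K : Matrix (Fin n) (Fin n) ℝ × Matrix (Fin n) (Fin p) ℝ × Matrix (Fin m) (Fin n) ℝ) :
    Matrix (Fin n ⊕ Fin n) (Fin n ⊕ Fin n) ℝ :=
  fromBlocks A (B * K.2.2) (K.2.1 * C) K.1

/-- `M_W(K) = diag(W, B_K V B_Kᵀ)`. -/
def MW {n m p : ℕ} (W : Matrix (Fin n) (Fin n) ℝ) (V : Matrix (Fin p) (Fin p) ℝ)
    (K : Matrix (Fin n) (Fin n) ℝ × Matrix (Fin n) (Fin p) ℝ × Matrix (Fin m) (Fin n) ℝ) :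
    Matrix (Fin n ⊕ Fin n) (Fin n ⊕ Fin n) ℝ :=
  fromBlocks W 0 0 (K.2.1 * V * (K.2.1)ᵀ)

/-- `M_Q(K) = diag(Q, C_Kᵀ R C_K)`. -/
def MQ {n m p : ℕ} (Q : Matrix (Fin n) (Fin n) ℝ) (R : Matrix (Fin m) (Fin m) ℝ)
    (K : Matrix (Fin n) (Fin n) ℝ × Matrix (Fin n) (Fin p) ℝ × Matrix (Fin m) (Fin n) ℝ) :
    Matrix (Fin n ⊕ Fin n) (Fin n ⊕ Fin n) ℝ :=
  fromBlocks Q 0 0 ((K.2.2)ᵀ * R * K.2.2)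

/-- `G_A = 2(Y₁₂ᵀ X₁₂ + Y₂₂ X₂₂)`. -/
def gradA {n : ℕ} (X Y : Matrix (Fin n ⊕ Fin n) (Fin n ⊕ Fin n) ℝ) :
    Matrix (Fin n) (Fin n) ℝ :=
  (2 : ℝ) • ((Y.toBlocks₁₂)ᵀ * X.toBlocks₁₂ + Y.toBlocks₂₂ * X.toBlocks₂₂)

/-- `G_B = 2(Y₂₂ B_K V + Y₂₂ X₁₂ᵀ Cᵀ + Y₁₂ᵀ X₁₁ Cᵀ)`. -/
def gradB {n m p : ℕ} (C : Matrix (Fin p) (Fin n) ℝ) (V : Matrix (Fin p) (Fin p) ℝ)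
    (K : Matrix (Fin n) (Fin n) ℝ × Matrix (Fin n) (Fin p) ℝ × Matrix (Fin m) (Fin n) ℝ)
    (X Y : Matrix (Fin n ⊕ Fin n) (Fin n ⊕ Fin n) ℝ) : Matrix (Fin n) (Fin p) ℝ :=
  (2 : ℝ) • (Y.toBlocks₂₂ * K.2.1 * V + Y.toBlocks₂₂ * (X.toBlocks₁₂)ᵀ * Cᵀ
    + (Y.toBlocks₁₂)ᵀ * X.toBlocks₁₁ * Cᵀ)

/-- `G_C = 2(R C_K X₂₂ + Bᵀ Y₁₁ X₁₂ + Bᵀ Y₁₂ X₂₂)`. -/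
def gradC {n m p : ℕ} (B : Matrix (Fin n) (Fin m) ℝ) (R : Matrix (Fin m) (Fin m) ℝ)
    (K : Matrix (Fin n) (Fin n) ℝ × Matrix (Fin n) (Fin p) ℝ × Matrix (Fin m) (Fin n) ℝ)
    (X Y : Matrix (Fin n ⊕ Fin n) (Fin n ⊕ Fin n) ℝ) : Matrix (Fin m) (Fin n) ℝ :=
  (2 : ℝ) • (R * K.2.2 * X.toBlocks₂₂ + Bᵀ * Y.toBlocks₁₁ * X.toBlocks₁₂
    + Bᵀ * Y.toBlocks₁₂ * X.toBlocks₂₂)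

/-- Uniqueness for the homogeneous Lyapunov equation with a stable matrix. -/
theorem lyap_unique {n : ℕ} (A D : Matrix (Fin n) (Fin n) ℝ)
    (hA : IsStableMatrix A) (h : A * D + D * Aᵀ = 0) : D = 0 := by
  set M : Matrix (Fin n) (Fin n) ℂ := A.map (algebraMap ℝ ℂ) with hM
  set E : Matrix (Fin n) (Fin n) ℂ := D.map (algebraMap ℝ ℂ) with hE
  have h1 : M * E + E * Mᵀ = 0 := by
    have := congrArg (fun Z : Matrix (Fin n) (Fin n) ℝ => (algebraMap ℝ ℂ).mapMatrix Z) h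
    simpa [map_add, map_mul, hM, hE, Matrix.transpose_map] using this
  have h2 : M * E = E * (-Mᵀ) := by
    rw [mul_neg]; exact eq_neg_of_add_eq_zero_left h1
  have h3 : ∀ q : Polynomial ℂ,
      Polynomial.aeval M q * E = E * Polynomial.aeval (-Mᵀ) q := by
    intro q
    induction q using Polynomial.induction_on' with
    | add p q hp hq => simp only [map_add, add_mul, mul_add, hp, hq]
    | monomial k a =>
      have hk : M ^ k * E = E * (-Mᵀ) ^ k := by
        induction k with
        | zero => simp
        | succ k ih => rw [pow_succ, mul_assoc, h2, ← mul_assoc, ih, mul_assoc, ← pow_succ]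
      simp only [Polynomial.aeval_monomial, Algebra.algebraMap_eq_smul_one, smul_mul_assoc,
        one_mul, mul_smul_comm, hk]
  have h4 := h3 M.charpoly
  rw [Matrix.aeval_self_charpoly, zero_mul] at h4
  have hu : IsUnit (Polynomial.aeval (-Mᵀ) M.charpoly) := by
    rw [← spectrum.zero_notMem_iff ℂ]
    intro h0
    rw [spectrum.map_polynomial_aeval_of_degree_pos] at h0
    · obtain ⟨k, hk, hk0⟩ := h0
      have a1 : k ∈ spectrum ℂ M := Matrix.mem_spectrum_iff_isRoot_charpoly.2 hk0
      have a2 : -k ∈ spectrum ℂ M := by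
        rw [← spectrum.neg_eq, Set.mem_neg] at hk
        rw [Matrix.mem_spectrum_iff_isRoot_charpoly] at hk ⊢
        rwa [Matrix.charpoly_transpose] at hk
      have b1 := hA _ a1
      have b2 := hA _ a2
      simp at b2
      linarith
    · rcases Nat.eq_zero_or_pos n with rfl | hn
      · exact absurd (isUnit_of_subsingleton _) ((spectrum.zero_mem_iff ℂ).1 h0)
      · rw [Matrix.charpoly_degree_eq_dim]; simpa using hn
  have hE0 : E = 0 := by
    rw [← hu.mul_left_inj, ← h4, zero_mul]
  ext i j
  have := congrFun (congrFun hE0 i) j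
  simpa [hE] using this

theorem lyap_symm {n : ℕ} (A X W : Matrix (Fin n) (Fin n) ℝ)
    (hA : IsStableMatrix A) (hW : Wᵀ = W) (h : A * X + X * Aᵀ + W = 0) : Xᵀ = X := by
  have ht := congrArg Matrix.transpose h
  simp only [transpose_add, transpose_mul, transpose_transpose, transpose_zero, hW] at ht
  have := lyap_unique A (Xᵀ - X) hA (by
    rw [mul_sub, sub_mul]
    have e : A * Xᵀ - A * X + (Xᵀ * Aᵀ - X * Aᵀ)
      = (X.transpose.transpose * 0 + (A * Xᵀ + Xᵀ * Aᵀ + W)) - (A * X + X * Aᵀ + W) := by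
      rw [mul_zero]; abel
    rw [e, h, mul_zero, zero_add, sub_zero, ← ht]; abel)
  exact sub_eq_zero.1 this

theorem stable_transpose {n : ℕ} (A : Matrix (Fin n) (Fin n) ℝ)
    (hA : IsStableMatrix A) : IsStableMatrix Aᵀ := by
  intro k hk
  apply hA
  rw [Matrix.mem_spectrum_iff_isRoot_charpoly] at hk ⊢
  rwa [Matrix.transpose_map, Matrix.charpoly_transpose] at hk

theorem stable_blocks {n : ℕ} (A L : Matrix (Fin n) (Fin n) ℝ)
    (hA : IsStableMatrix A) (hL : IsStableMatrix L) :
    IsStableMatrix (fromBlocks A 0 0 L) := by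
  intro k hk
  rw [Matrix.mem_spectrum_iff_isRoot_charpoly, Matrix.fromBlocks_map] at hk
  simp only [Matrix.map_zero _ (map_zero (algebraMap ℝ ℂ)),
    Matrix.charpoly_fromBlocks_zero₁₂, Polynomial.IsRoot, Polynomial.eval_mul,
    mul_eq_zero] at hk
  rcases hk with hk | hk
  · exact hA _ (Matrix.mem_spectrum_iff_isRoot_charpoly.2 hk)
  · exact hL _ (Matrix.mem_spectrum_iff_isRoot_charpoly.2 hk)

/-- For an open-loop stable plant and any stable `Λ`, the decoupled
controller `K* = (Λ, 0, 0)` is a stabilizing stationary point of the LQG cost: with `X_op`,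
`Y_op` solving the plant Lyapunov equations, `X = diag(X_op, 0)` and `Y = diag(Y_op, 0)`
are symmetric solutions of the `X`- and `Y`-Lyapunov equations for `K*`, and all the
gradient expressions vanish. -/
theorem open_loop_stable_stationary_point (n m p : ℕ)
    (hn : 0 < n) (hm : 0 < m) (hp : 0 < p)
    (A : Matrix (Fin n) (Fin n) ℝ) (B : Matrix (Fin n) (Fin m) ℝ)
    (C : Matrix (Fin p) (Fin n) ℝ)
    (Q W : Matrix (Fin n) (Fin n) ℝ) (R : Matrix (Fin m) (Fin m) ℝ)
    (V : Matrix (Fin p) (Fin p) ℝ)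
    (hQ : Q.PosSemidef) (hW : W.PosSemidef) (hR : R.PosDef) (hV : V.PosDef)
    (hA : IsStableMatrix A)
    (Lam : Matrix (Fin n) (Fin n) ℝ) (hLam : IsStableMatrix Lam)
    (Xop Yop : Matrix (Fin n) (Fin n) ℝ)
    (hXop : A * Xop + Xop * Aᵀ + W = 0)
    (hYop : Aᵀ * Yop + Yop * A + Q = 0)
    (Kstar : Matrix (Fin n) (Fin n) ℝ × Matrix (Fin n) (Fin p) ℝ × Matrix (Fin m) (Fin n) ℝ)
    (hKstar : Kstar = (Lam, 0, 0)) :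
    IsStableMatrix (Acl A B C Kstar) ∧
    (fromBlocks Xop 0 0 (0 : Matrix (Fin n) (Fin n) ℝ)).IsSymm ∧
    Acl A B C Kstar * fromBlocks Xop 0 0 (0 : Matrix (Fin n) (Fin n) ℝ)
      + fromBlocks Xop 0 0 (0 : Matrix (Fin n) (Fin n) ℝ) * (Acl A B C Kstar)ᵀ
      + MW W V Kstar = 0 ∧
    (fromBlocks Yop 0 0 (0 : Matrix (Fin n) (Fin n) ℝ)).IsSymm ∧
    (Acl A B C Kstar)ᵀ * fromBlocks Yop 0 0 (0 : Matrix (Fin n) (Fin n) ℝ)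
      + fromBlocks Yop 0 0 (0 : Matrix (Fin n) (Fin n) ℝ) * Acl A B C Kstar
      + MQ Q R Kstar = 0 ∧
    gradA (fromBlocks Xop 0 0 0) (fromBlocks Yop 0 0 0) = 0 ∧
    gradB C V Kstar (fromBlocks Xop 0 0 0) (fromBlocks Yop 0 0 0) = 0 ∧
    gradC B R Kstar (fromBlocks Xop 0 0 0) (fromBlocks Yop 0 0 0) = 0 := by
  subst hKstar
  have hWt : Wᵀ = W := by simpa [Matrix.IsSymm] using hW.isHermitian
  have hQt : Qᵀ = Q := by simpa [Matrix.IsSymm] using hQ.isHermitian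
  have hX := lyap_symm A Xop W hA hWt hXop
  have hY := lyap_symm Aᵀ Yop Q (stable_transpose A hA) hQt (by simpa using hYop)
  have hcl : Acl A B C (Lam, (0 : Matrix (Fin n) (Fin p) ℝ), (0 : Matrix (Fin m) (Fin n) ℝ))
      = fromBlocks A 0 0 Lam := by simp [Acl]
  rw [hcl]
  refine ⟨stable_blocks A Lam hA hLam, ?_, ?_, ?_, ?_, ?_, ?_, ?_⟩
  · simp [Matrix.IsSymm, fromBlocks_transpose, hX]
  · simp [MW, fromBlocks_transpose, fromBlocks_multiply, fromBlocks_add, hXop]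
  · simp [Matrix.IsSymm, fromBlocks_transpose, hY]
  · simp [MQ, fromBlocks_transpose, fromBlocks_multiply, fromBlocks_add, hYop]
  · simp [gradA]
  · simp [gradB]
  · simp [gradC]
end
end

section
/- Let K = (A_K, B_K, C_K) ∈ 𝒞_n be a full-order controller, and suppose X and Y are positive-definite symmetric solutions of the X-equation and Y-equation for K (as holds for every minimal K ∈ 𝒞_n) such that the LQG gradient expressions of K computed from X and Y all vanish. Define P := X11 − X12·X22⁻¹·X12ᵀ, S := Y11 − Y12·Y22⁻¹·Y12ᵀ, and T := Y22⁻¹·Y12ᵀ. Then: (i) P and S are positive definite; (ii) T is invertible with T⁻¹ = −X12·X22⁻¹; (iii) P satisfies the algebraic Riccati equation A·P + P·Aᵀ − P·Cᵀ·V⁻¹·C·P + W = 0, and S satisfies Aᵀ·S + S·A − S·B·R⁻¹·Bᵀ·S + Q = 0; (iv) with K_g := R⁻¹·Bᵀ·S and L := P·Cᵀ·V⁻¹, the controller has the form A_K = T·(A − B·K_g − L·C)·T⁻¹, B_K = −T·L, C_K = K_g·T⁻¹. Thus every minimal stationary point of the LQG problem over 𝒞_n is, up to a similarity transformation, the controller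 determined by the two Riccati equations. -/
open Matrix

noncomputable section

theorem schur_posDef {n : ℕ} (X : Matrix (Fin n ⊕ Fin n) (Fin n ⊕ Fin n) ℝ) (hX : X.PosDef)
    (hs : X.toBlocks₂₁ = (X.toBlocks₁₂)ᵀ) :
    X.toBlocks₂₂.PosDef ∧
    (X.toBlocks₁₁ - X.toBlocks₁₂ * (X.toBlocks₂₂)⁻¹ * (X.toBlocks₁₂)ᵀ).PosDef := by
  have h22 : X.toBlocks₂₂.PosDef := hX.submatrix Sum.inr_injective
  refine ⟨h22, ?_⟩
  let _ := h22.isUnit.invertible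
  have hXe : X = fromBlocks X.toBlocks₁₁ X.toBlocks₁₂ (X.toBlocks₁₂)ᵀ X.toBlocks₂₂ := by
    rw [← hs, fromBlocks_toBlocks]
  have hps : (X.toBlocks₁₁ - X.toBlocks₁₂ * (X.toBlocks₂₂)⁻¹ * (X.toBlocks₁₂)ᵀ).PosSemidef := by
    have := (PosDef.fromBlocks₂₂ X.toBlocks₁₁ X.toBlocks₁₂ h22).1 (by
      rw [conjTranspose_eq_transpose_of_trivial, ← hXe]; exact hX.posSemidef)
    rwa [conjTranspose_eq_transpose_of_trivial] at this
  rw [hps.posDef_iff_det_ne_zero]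
  intro h0
  have h1 := (isUnit_iff_isUnit_det _).1 hX.isUnit
  rw [hXe, det_fromBlocks₂₂, invOf_eq_nonsing_inv, h0] at h1
  simp at h1

/-- The square (ring) part of the argument. -/
theorem core_ring {n : ℕ} {A P S T U E F AK W Q LC BC LVL KRK : Matrix (Fin n) (Fin n) ℝ}
    (hTU : T * U = 1) (hUT : U * T = 1) (hE : IsUnit E)
    (hPs : Pᵀ = P) (hSs : Sᵀ = S) (hEs : Eᵀ = E) (hFs : Fᵀ = F)
    -- BC = B * C_K * T = B * K_g,  LC = L * C,  B_K * C = -(T * LC),  LVL = L V Lᵀ = P * LCᵀ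
    (hLVL : LVL = P * LCᵀ) (hKRK : KRK = S * BC)
    (x11 : A * (P + U * E * Uᵀ) + BC * U * (-(U * E))ᵀ
      + ((P + U * E * Uᵀ) * Aᵀ + (-(U * E)) * (BC * U)ᵀ) + W = 0)
    (x12 : A * (-(U * E)) + BC * U * E + ((P + U * E * Uᵀ) * (-(T * LC))ᵀ + (-(U * E)) * AKᵀ) = 0)
    (x22 : -(T * LC) * (-(U * E)) + AK * E + ((-(U * E))ᵀ * (-(T * LC))ᵀ + E * AKᵀ)
      + T * LVL * Tᵀ = 0)
    (y11 : Aᵀ * (S + Tᵀ * F * T) + (-(T * LC))ᵀ * (F * T)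
      + ((S + Tᵀ * F * T) * A + (Tᵀ * F) * (-(T * LC))) + Q = 0)
    (y22 : (BC * U)ᵀ * (Tᵀ * F) + AKᵀ * F + (F * T * (BC * U) + F * AK) + Uᵀ * KRK * U = 0) :
    A * P + P * Aᵀ - LVL + W = 0 ∧ Aᵀ * S + S * A - KRK + Q = 0 ∧
    AK = T * (A - BC - LC) * U := by
  have hUTt : Tᵀ * Uᵀ = 1 := by rw [← transpose_mul, hUT, transpose_one]
  have hTUt : Uᵀ * Tᵀ = 1 := by rw [← transpose_mul, hTU, transpose_one]
  simp only [transpose_neg, transpose_mul, hEs] at x11 x12 x22 y11 y22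
  have hUT' : ∀ Z : Matrix (Fin n) (Fin n) ℝ, U * (T * Z) = Z := fun Z => by
    rw [← Matrix.mul_assoc, hUT, Matrix.one_mul]
  have hTU' : ∀ Z : Matrix (Fin n) (Fin n) ℝ, T * (U * Z) = Z := fun Z => by
    rw [← Matrix.mul_assoc, hTU, Matrix.one_mul]
  have hUTt' : ∀ Z : Matrix (Fin n) (Fin n) ℝ, Tᵀ * (Uᵀ * Z) = Z := fun Z => by
    rw [← Matrix.mul_assoc, hUTt, Matrix.one_mul]
  have hTUt' : ∀ Z : Matrix (Fin n) (Fin n) ℝ, Uᵀ * (Tᵀ * Z) = Z := fun Z => by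
    rw [← Matrix.mul_assoc, hTUt, Matrix.one_mul]
  have hAK : AK = T * (A - BC - LC) * U := by
    have h0 : (U * AK - (A - BC - LC) * U) * E = 0 := by
      have h1 := congrArg (fun Z => U * Z) x22
      have h2 := congrArg₂ (· + ·) x12 h1
      rw [← sub_eq_zero] at h2
      rw [← h2]
      simp only [hLVL, Matrix.mul_assoc, Matrix.mul_add, Matrix.add_mul, Matrix.mul_sub,
        Matrix.sub_mul, Matrix.neg_mul, Matrix.mul_neg, hUT', hTU', hUTt', hTUt',
        Matrix.mul_zero]
      abel
    have h3 : U * AK - (A - BC - LC) * U = 0 := by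
      obtain ⟨u, rfl⟩ := hE
      simpa using h0
    rw [sub_eq_zero] at h3
    rw [Matrix.mul_assoc, ← h3, hTU']
  refine ⟨?_, ?_, hAK⟩
  · have h1 := congrArg (fun Z => U * Z * Uᵀ) x22
    have h2 := congrArg₂ (· - ·) x11 h1
    rw [← sub_eq_zero] at h2
    rw [← h2, hAK]
    simp only [transpose_mul, transpose_sub, Matrix.mul_assoc, Matrix.mul_add, Matrix.add_mul, Matrix.mul_sub,
        Matrix.sub_mul, Matrix.neg_mul, Matrix.mul_neg, hUT', hTU', hUTt', hTUt',
        hUT, hTU, hUTt, hTUt, Matrix.mul_one, Matrix.mul_zero, Matrix.zero_mul]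
    abel
  · have h1 := congrArg (fun Z => Tᵀ * Z * T) y22
    have h2 := congrArg₂ (· - ·) y11 h1
    rw [← sub_eq_zero] at h2
    rw [← h2, hAK]
    simp only [transpose_mul, transpose_sub, Matrix.mul_assoc, Matrix.mul_add, Matrix.add_mul, Matrix.mul_sub,
        Matrix.sub_mul, Matrix.neg_mul, Matrix.mul_neg, hUT', hTU', hUTt', hTUt',
        hUT, hTU, hUTt, hTUt, Matrix.mul_one, Matrix.mul_zero, Matrix.zero_mul]
    abel

/-- Every minimal stationary point of the LQG problem over `𝒞_n` is, up
to a similarity transformation, the controller determined by the two algebraic Riccati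
equations: if `K ∈ 𝒞_n` and `X`, `Y` are positive-definite symmetric solutions of the
Lyapunov equations for `K` at which all gradient expressions vanish, then with
`P = X₁₁ − X₁₂ X₂₂⁻¹ X₁₂ᵀ`, `S = Y₁₁ − Y₁₂ Y₂₂⁻¹ Y₁₂ᵀ` and `T = Y₂₂⁻¹ Y₁₂ᵀ`:
`P, S ≻ 0`; `T` is invertible with `T⁻¹ = −X₁₂ X₂₂⁻¹`; `P` and `S` satisfy the two
Riccati equations; and `A_K = T(A − B K_g − L C)T⁻¹`, `B_K = −T L`, `C_K = K_g T⁻¹`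
with `K_g = R⁻¹ Bᵀ S` and `L = P Cᵀ V⁻¹`. -/
theorem minimal_stationary_points_riccati (n m p : ℕ)
    (hn : 0 < n) (hm : 0 < m) (hp : 0 < p)
    (A : Matrix (Fin n) (Fin n) ℝ) (B : Matrix (Fin n) (Fin m) ℝ)
    (C : Matrix (Fin p) (Fin n) ℝ)
    (Q W : Matrix (Fin n) (Fin n) ℝ) (R : Matrix (Fin m) (Fin m) ℝ)
    (V : Matrix (Fin p) (Fin p) ℝ)
    (hQ : Q.PosSemidef) (hW : W.PosSemidef) (hR : R.PosDef) (hV : V.PosDef)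
    (K : Matrix (Fin n) (Fin n) ℝ × Matrix (Fin n) (Fin p) ℝ × Matrix (Fin m) (Fin n) ℝ)
    (hK : IsStableMatrix (Acl A B C K))
    (X Y : Matrix (Fin n ⊕ Fin n) (Fin n ⊕ Fin n) ℝ)
    (hXsymm : X.IsSymm) (hYsymm : Y.IsSymm)
    (hXpd : X.PosDef) (hYpd : Y.PosDef)
    (hX : Acl A B C K * X + X * (Acl A B C K)ᵀ + MW W V K = 0)
    (hY : (Acl A B C K)ᵀ * Y + Y * Acl A B C K + MQ Q R K = 0)
    (hGA : gradA X Y = 0) (hGB : gradB C V K X Y = 0) (hGC : gradC B R K X Y = 0) :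
    ∀ P S T : Matrix (Fin n) (Fin n) ℝ,
      P = X.toBlocks₁₁ - X.toBlocks₁₂ * (X.toBlocks₂₂)⁻¹ * (X.toBlocks₁₂)ᵀ →
      S = Y.toBlocks₁₁ - Y.toBlocks₁₂ * (Y.toBlocks₂₂)⁻¹ * (Y.toBlocks₁₂)ᵀ →
      T = (Y.toBlocks₂₂)⁻¹ * (Y.toBlocks₁₂)ᵀ →
      P.PosDef ∧ S.PosDef ∧
      IsUnit T.det ∧ T⁻¹ = -(X.toBlocks₁₂ * (X.toBlocks₂₂)⁻¹) ∧
      A * P + P * Aᵀ - P * Cᵀ * V⁻¹ * C * P + W = 0 ∧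
      Aᵀ * S + S * A - S * B * R⁻¹ * Bᵀ * S + Q = 0 ∧
      K.1 = T * (A - B * (R⁻¹ * Bᵀ * S) - P * Cᵀ * V⁻¹ * C) * T⁻¹ ∧
      K.2.1 = -(T * (P * Cᵀ * V⁻¹)) ∧
      K.2.2 = R⁻¹ * Bᵀ * S * T⁻¹ := by
  intro P S T hP hS hT
  have hX21 : X.toBlocks₂₁ = (X.toBlocks₁₂)ᵀ := by
    ext i j; exact (hXsymm.apply (Sum.inl j) (Sum.inr i)).symm.symm
  have hY21 : Y.toBlocks₂₁ = (Y.toBlocks₁₂)ᵀ := by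
    ext i j; exact (hYsymm.apply (Sum.inl j) (Sum.inr i)).symm.symm
  obtain ⟨hE, hPpd⟩ := schur_posDef X hXpd hX21
  obtain ⟨hF, hSpd⟩ := schur_posDef Y hYpd hY21
  rw [← hP] at hPpd
  rw [← hS] at hSpd
  rw [← fromBlocks_toBlocks X, hX21] at hX
  rw [← fromBlocks_toBlocks Y, hY21] at hY
  unfold gradA at hGA
  unfold gradB at hGB
  unfold gradC at hGC
  obtain ⟨AK, BK, CK⟩ := K
  simp only [Acl, MW, MQ] at hX hY hGB hGC ⊢
  generalize X.toBlocks₁₁ = X11 at *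
  generalize X.toBlocks₁₂ = X12 at *
  generalize X.toBlocks₂₂ = E at *
  generalize Y.toBlocks₁₁ = Y11 at *
  generalize Y.toBlocks₁₂ = Y12 at *
  generalize Y.toBlocks₂₂ = F at *
  have sym : ∀ {k : ℕ} {M : Matrix (Fin k) (Fin k) ℝ}, M.PosDef → Mᵀ = M := fun h => by
    have := h.1.eq
    rwa [conjTranspose_eq_transpose_of_trivial] at this
  have hEs := sym hE
  have hFs := sym hF
  have hPs := sym hPpd
  have hSs := sym hSpd
  have hVs := sym hV
  have hRs := sym hR
  have dE := (isUnit_iff_isUnit_det _).1 hE.isUnit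
  have dF := (isUnit_iff_isUnit_det _).1 hF.isUnit
  have dV := (isUnit_iff_isUnit_det _).1 hV.isUnit
  have dR := (isUnit_iff_isUnit_det _).1 hR.isUnit
  obtain ⟨U, hU⟩ : ∃ U, U = -(X12 * E⁻¹) := ⟨_, rfl⟩
  have hX12 : X12 = -(U * E) := by
    rw [hU, Matrix.neg_mul, neg_neg, nonsing_inv_mul_cancel_right _ _ dE]
  have hY12t : Y12ᵀ = F * T := by
    rw [hT, mul_nonsing_inv_cancel_left _ _ dF]
  have hY12 : Y12 = Tᵀ * F := by
    rw [← transpose_transpose Y12, hY12t, transpose_mul, hFs]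
  have hX11 : X11 = P + U * E * Uᵀ := by
    rw [hP, hX12]
    simp only [transpose_neg, transpose_mul, hEs, Matrix.neg_mul, Matrix.mul_neg, neg_neg]
    rw [mul_nonsing_inv_cancel_right _ _ dE, Matrix.mul_assoc]
    abel
  have hY11 : Y11 = S + Tᵀ * F * T := by
    rw [hS, hY12t, hY12, mul_nonsing_inv_cancel_right _ _ dF, Matrix.mul_assoc]
    abel
  rw [smul_eq_zero_iff_right two_ne_zero] at hGA hGB hGC
  have hTU : T * U = 1 := by
    rw [hY12t, hX12] at hGA
    have h1 : F * ((1 - T * U) * E) = 0 := by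
      rw [← hGA, Matrix.sub_mul, Matrix.mul_sub, Matrix.one_mul]
      simp only [Matrix.mul_neg, Matrix.mul_assoc]
      abel
    have h2 : (1 - T * U) * E = 0 := by
      rw [← nonsing_inv_mul_cancel_left F ((1 - T * U) * E) dF, h1, Matrix.mul_zero]
    have h3 : 1 - T * U = 0 := by
      rw [← mul_nonsing_inv_cancel_right E (1 - T * U) dE, h2, Matrix.zero_mul]
    exact (sub_eq_zero.1 h3).symm
  have hUT : U * T = 1 := mul_eq_one_comm.1 hTU
  have hTinv : T⁻¹ = U := inv_eq_right_inv hTU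
  have hTU'' : ∀ {k : ℕ} (Z : Matrix (Fin n) (Fin k) ℝ), T * (U * Z) = Z := fun Z => by
    rw [← Matrix.mul_assoc, hTU, Matrix.one_mul]
  have hBK : BK = -(T * (P * Cᵀ * V⁻¹)) := by
    rw [hY12t, hX11, hX12] at hGB
    have h1 : F * (BK * V + T * P * Cᵀ) = 0 := by
      rw [← hGB]
      simp only [transpose_neg, transpose_mul, hEs, Matrix.neg_mul, Matrix.mul_neg,
        Matrix.mul_add, Matrix.add_mul, Matrix.mul_assoc, hTU'']
      abel
    have h2 : BK * V + T * P * Cᵀ = 0 := by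
      rw [← nonsing_inv_mul_cancel_left F (BK * V + T * P * Cᵀ) dF, h1, Matrix.mul_zero]
    rw [← mul_nonsing_inv_cancel_right V BK dV, eq_neg_of_add_eq_zero_left h2]
    simp only [Matrix.neg_mul, Matrix.mul_assoc]
  have hCK : CK = R⁻¹ * Bᵀ * S * U := by
    rw [hY11, hY12, hX12] at hGC
    have h1 : (R * CK - Bᵀ * S * U) * E = 0 := by
      rw [← hGC]
      simp only [Matrix.neg_mul, Matrix.mul_neg, Matrix.sub_mul,
        Matrix.mul_add, Matrix.add_mul, Matrix.mul_assoc, hTU'']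
      abel
    have h2 : R * CK - Bᵀ * S * U = 0 := by
      rw [← mul_nonsing_inv_cancel_right E (R * CK - Bᵀ * S * U) dE, h1, Matrix.zero_mul]
    rw [← nonsing_inv_mul_cancel_left R CK dR, sub_eq_zero.1 h2]
    simp only [Matrix.mul_assoc]
  rw [hTinv]
  refine ⟨hPpd, hSpd, ?_, hU, ?_⟩
  · exact (isUnit_iff_isUnit_det _).1 (IsUnit.of_mul_eq_one U hTU)
  simp only [fromBlocks_transpose, fromBlocks_multiply, fromBlocks_add, transpose_transpose,
    ← fromBlocks_zero, fromBlocks_inj] at hX hY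
  obtain ⟨x11, x12, -, x22⟩ := hX
  obtain ⟨y11, -, -, y22⟩ := hY
  rw [hY12t] at y11 y22
  rw [hX11, hX12] at x11 x12
  rw [hX12] at x22
  rw [hY11, hY12] at y11
  rw [hY12] at y22
  have hBKC : BK * C = -(T * (P * Cᵀ * V⁻¹ * C)) := by
    rw [hBK]; simp only [Matrix.neg_mul, Matrix.mul_assoc]
  have hBCK : B * CK = B * (R⁻¹ * Bᵀ * S) * U := by
    rw [hCK]; simp only [Matrix.mul_assoc]
  have hVit : (V⁻¹)ᵀ = V⁻¹ := by rw [transpose_nonsing_inv, hVs]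
  have hRit : (R⁻¹)ᵀ = R⁻¹ := by rw [transpose_nonsing_inv, hRs]
  have hBVB : BK * V * BKᵀ = T * (P * Cᵀ * V⁻¹ * C * P) * Tᵀ := by
    rw [hBK]
    simp only [transpose_neg, transpose_mul, hVit, hPs, transpose_transpose, Matrix.neg_mul,
      Matrix.mul_neg, neg_neg, Matrix.mul_assoc, mul_nonsing_inv_cancel_left _ _ dV]
  have hCRC : CKᵀ * R * CK = Uᵀ * (S * B * R⁻¹ * Bᵀ * S) * U := by
    rw [hCK]
    simp only [transpose_mul, hRit, hSs, transpose_transpose,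
      Matrix.mul_assoc, mul_nonsing_inv_cancel_left _ _ dR]
  have := core_ring (A := A) (P := P) (S := S) (T := T) (U := U) (E := E) (F := F) (AK := AK)
    (W := W) (Q := Q) (LC := P * Cᵀ * V⁻¹ * C) (BC := B * (R⁻¹ * Bᵀ * S))
    (LVL := P * Cᵀ * V⁻¹ * C * P) (KRK := S * B * R⁻¹ * Bᵀ * S) hTU hUT hE.isUnit hPs hSs hEs hFs
    (by simp only [transpose_mul, hVit, hPs, transpose_transpose, Matrix.mul_assoc])
    (by simp only [Matrix.mul_assoc])
    (by rw [← hBCK]; simpa using x11) (by rw [← hBKC, ← hBCK]; simpa using x12)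
    (by rw [← hBKC, ← hBVB]; exact x22) (by rw [← hBKC]; exact y11)
    (by rw [← hCRC, ← hBCK, Matrix.mul_assoc F T]; simpa [Matrix.mul_assoc] using y22)
  exact ⟨this.1, this.2.1, this.2.2, hBK, hCK⟩
end
end
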